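/- (Uni-peak entropy identity.) Let f : ℤ → ℕ be finitely supported with V(f) > 0, and suppose f is uni-peak: for every elevation h with 1 ≤ h ≤ max f, the level set S_h(f) consists of exactly one run, of length ℓ_h = |S_h(f)|, and assume the lengths ℓ₁, ℓ₂, …, ℓ_{max f} are pairwise distinct. Then for each k ≥ 1, p_k(f) = k/V(f) if k = ℓ_h for some h, and p_k(f) = 0 otherwise; consequently the granulometric index equals the entropy of the normalized discrete derivatives of volume: GI(f) = −Σ_{h=1}^{max f} (ℓ_h / V(f)) · log(ℓ_h / V(f)). -/

import Mathlib

namespace Granulo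

/-- Opening of a one-dimensional DEM `f` by a segment of length `k` (closed form):
`(γₖ f)(x) = max{ min{ f(y) : a ≤ y ≤ a+k−1 } : a ≤ x ≤ a+k−1 }`. -/
noncomputable def opening (k : ℕ) (f : ℤ → ℕ) (x : ℤ) : ℕ :=
  sSup {m : ℕ | ∃ a : ℤ, a ≤ x ∧ x ≤ a + (k : ℤ) - 1 ∧
    m = sInf {n : ℕ | ∃ y : ℤ, a ≤ y ∧ y ≤ a + (k : ℤ) - 1 ∧ n = f y}}

/-- Volume of a one-dimensional DEM. -/
noncomputable def vol (f : ℤ → ℕ) : ℕ := ∑ᶠ x : ℤ, f x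

/-- Level set `S_h(f) = {x : f x ≥ h}`. -/
def levelSet (h : ℕ) (f : ℤ → ℕ) : Set ℤ := {x : ℤ | h ≤ f x}

/-- A set of consecutive integers. -/
def IsInterval (R : Set ℤ) : Prop :=
  ∀ a ∈ R, ∀ b ∈ R, ∀ c : ℤ, a ≤ c → c ≤ b → c ∈ R

/-- `R` is a run of `S`: a maximal nonempty set of consecutive integers contained in `S`. -/
def IsRun (S R : Set ℤ) : Prop :=
  R.Nonempty ∧ R ⊆ S ∧ IsInterval R ∧
    ∀ R' : Set ℤ, R ⊆ R' → R' ⊆ S → IsInterval R' → R' = R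

/-- `n_{t,h}(f)`: number of runs of `S_h(f)` of cardinality `t`. -/
noncomputable def runCount (f : ℤ → ℕ) (t h : ℕ) : ℕ :=
  {R : Set ℤ | IsRun (levelSet h f) R ∧ R.ncard = t}.ncard

/-- Granulometric probability `p_k(f) = (V(γₖ f) − V(γ_{k+1} f))/V(f)`. -/
noncomputable def p (k : ℕ) (f : ℤ → ℕ) : ℝ :=
  ((vol (opening k f) : ℝ) - (vol (opening (k+1) f) : ℝ)) / (vol f : ℝ)

/-- Granulometric index `GI(f) = −Σ_{k≥1} p_k log p_k` (terms with `p_k = 0` are `0`). -/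
noncomputable def gi (f : ℤ → ℕ) : ℝ :=
  -∑ᶠ k ∈ Set.Ici (1 : ℕ), p k f * Real.log (p k f)

/-- Volume of a two-dimensional DEM. -/
noncomputable def vol2 (f : ℤ × ℤ → ℕ) : ℕ := ∑ᶠ q : ℤ × ℤ, f q

/-- Horizontal opening: apply `γₖ` to each row `i ↦ f (i, ·)`. -/
noncomputable def hOpening (k : ℕ) (f : ℤ × ℤ → ℕ) : ℤ × ℤ → ℕ :=
  fun q => opening k (fun j => f (q.1, j)) q.2

/-- Row-wise run count `n_{t,h}^{(i)}(f)`. -/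
noncomputable def rowRunCount (f : ℤ × ℤ → ℕ) (i : ℤ) (t h : ℕ) : ℕ :=
  runCount (fun j => f (i, j)) t h

/-- Granulometric probability w.r.t. horizontal openings. -/
noncomputable def p2 (k : ℕ) (f : ℤ × ℤ → ℕ) : ℝ :=
  ((vol2 (hOpening k f) : ℝ) - (vol2 (hOpening (k+1) f) : ℝ)) / (vol2 f : ℝ)

/-- Granulometric index w.r.t. horizontal openings. -/
noncomputable def gi2 (f : ℤ × ℤ → ℕ) : ℝ :=
  -∑ᶠ k ∈ Set.Ici (1 : ℕ), p2 k f * Real.log (p2 k f)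


theorem le_opening_iff {f : ℤ → ℕ} {k h : ℕ} {x : ℤ} (hh : 1 ≤ h) :
    h ≤ opening k f x ↔ ∃ a : ℤ, a ≤ x ∧ x ≤ a + (k : ℤ) - 1 ∧
      ∀ y : ℤ, a ≤ y → y ≤ a + (k : ℤ) - 1 → h ≤ f y := by
  have hbdd : BddAbove {m : ℕ | ∃ a : ℤ, a ≤ x ∧ x ≤ a + (k : ℤ) - 1 ∧
      m = sInf {n : ℕ | ∃ y : ℤ, a ≤ y ∧ y ≤ a + (k : ℤ) - 1 ∧ n = f y}} := by
    refine ⟨f x, ?_⟩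
    rintro m ⟨a, h₁, h₂, rfl⟩
    exact Nat.sInf_le ⟨x, h₁, h₂, rfl⟩
  constructor
  · intro hle
    unfold opening at hle
    have hne : {m : ℕ | ∃ a : ℤ, a ≤ x ∧ x ≤ a + (k : ℤ) - 1 ∧
        m = sInf {n : ℕ | ∃ y : ℤ, a ≤ y ∧ y ≤ a + (k : ℤ) - 1 ∧ n = f y}}.Nonempty := by
      by_contra hempty
      rw [Set.not_nonempty_iff_eq_empty] at hempty
      rw [hempty] at hle
      simp at hle
      omega
    obtain ⟨a, h₁, h₂, hm⟩ := Nat.sSup_mem hne hbdd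
    rw [hm] at hle
    exact ⟨a, h₁, h₂, fun y hy₁ hy₂ => hle.trans (Nat.sInf_le ⟨y, hy₁, hy₂, rfl⟩)⟩
  · rintro ⟨a, h₁, h₂, hall⟩
    refine le_trans ?_ (le_csSup hbdd ⟨a, h₁, h₂, rfl⟩)
    refine le_csInf ⟨f x, x, h₁, h₂, rfl⟩ ?_
    rintro n ⟨y, hy₁, hy₂, rfl⟩
    exact hall y hy₁ hy₂

theorem opening_le {f : ℤ → ℕ} {k : ℕ} (x : ℤ) : opening k f x ≤ f x := by
  rcases Nat.eq_zero_or_pos (opening k f x) with h0 | hpos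
  · omega
  · obtain ⟨a, h₁, h₂, hall⟩ := (le_opening_iff hpos).1 le_rfl
    exact hall x h₁ h₂

theorem levelSet_finite {f : ℤ → ℕ} (hf : (Function.support f).Finite) {h : ℕ} (hh : 1 ≤ h) :
    (levelSet h f).Finite := by
  refine hf.subset fun x (hx : h ≤ f x) => ?_
  rw [Function.mem_support]
  omega

/-- The volume is the sum of the sizes of the level sets. -/
theorem vol_eq_sum_ncard_levelSet {g : ℤ → ℕ} (hg : (Function.support g).Finite) {M : ℕ}
    (hub : ∀ x, g x ≤ M) : vol g = ∑ h ∈ Finset.Icc 1 M, (levelSet h g).ncard := by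
  have hcake : ∀ x, g x = ∑ h ∈ Finset.Icc 1 M, if h ≤ g x then 1 else 0 := by
    intro x
    have : (Finset.Icc 1 M).filter (fun h => h ≤ g x) = Finset.Icc 1 (g x) := by
      ext h
      have := hub x
      simp only [Finset.mem_filter, Finset.mem_Icc]
      omega
    rw [← Finset.card_filter, this]
    simp
  unfold vol
  rw [finsum_eq_sum_of_support_subset g (s := hg.toFinset) (by simp),
    Finset.sum_congr rfl fun x _ => hcake x, Finset.sum_comm]
  refine Finset.sum_congr rfl fun h hh => ?_
  rw [← Finset.card_filter, ← Set.ncard_coe_finset]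
  congr 1
  ext x
  have := (Finset.mem_Icc.1 hh).1
  simp only [Finset.coe_filter, Set.Finite.mem_toFinset, Function.mem_support, Set.mem_ofPred_eq,
    levelSet]
  omega

/-- The maximal set of consecutive integers in `S` around a point of `S` is a run. -/
theorem isRun_component {S : Set ℤ} {x : ℤ} (hx : x ∈ S) :
    IsRun S {y | ∀ z, min x y ≤ z → z ≤ max x y → z ∈ S} := by
  refine ⟨⟨x, fun z h₁ h₂ => ?_⟩, fun y hy => hy y (by omega) (by omega), ?_, ?_⟩
  · obtain rfl : z = x := by omega
    exact hx
  · intro a ha b hb c hac hcb z h₁ h₂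
    by_cases hza : min x a ≤ z ∧ z ≤ max x a
    · exact ha z hza.1 hza.2
    · exact hb z (by omega) (by omega)
  · intro R' hsub hR'S hint
    refine Set.Subset.antisymm (fun y hy z h₁ h₂ => hR'S ?_) hsub
    have hxR : x ∈ R' := hsub fun z h₁ h₂ => by
      obtain rfl : z = x := by omega
      exact hx
    rcases le_total x y with hxy | hxy
    · exact hint x hxR y hy z (by omega) (by omega)
    · exact hint y hy x hxR z (by omega) (by omega)

theorem isRun_self_of_existsUnique {S : Set ℤ} (h : ∃! R, IsRun S R) : IsRun S S := by
  obtain ⟨R, hR, huniq⟩ := h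
  have hSR : S ⊆ R := fun x hx => by
    rw [← huniq _ (isRun_component hx)]
    intro z h₁ h₂
    obtain rfl : z = x := by omega
    exact hx
  rwa [hR.2.1.antisymm hSR] at hR

theorem IsInterval.exists_eq_Icc {S : Set ℤ} (hS : IsInterval S) (hne : S.Nonempty)
    (hfin : S.Finite) : ∃ a b : ℤ, a ≤ b ∧ S = Set.Icc a b := by
  obtain ⟨a, ha, hamin⟩ := Set.exists_min_image S id hfin hne
  obtain ⟨b, hb, hbmax⟩ := Set.exists_max_image S id hfin hne
  exact ⟨a, b, hamin b hb, Set.Subset.antisymm (fun x hx => ⟨hamin x hx, hbmax x hx⟩)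
    fun x hx => hS a ha b hb x hx.1 hx.2⟩

/-- The opening keeps a level set made of a single run if it is long enough, and otherwise
removes it. -/
theorem ncard_levelSet_opening {f : ℤ → ℕ} (hf : (Function.support f).Finite) {h k : ℕ}
    (hh : 1 ≤ h) (hk : 1 ≤ k) (hrun : IsRun (levelSet h f) (levelSet h f)) :
    (levelSet h (opening k f)).ncard =
      if k ≤ (levelSet h f).ncard then (levelSet h f).ncard else 0 := by
  obtain ⟨a, b, hab, hS⟩ := hrun.2.2.1.exists_eq_Icc hrun.1 (levelSet_finite hf hh)
  have hmem : ∀ y, h ≤ f y ↔ a ≤ y ∧ y ≤ b := fun y => Set.ext_iff.1 hS y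
  have hcard : (levelSet h f).ncard = (b + 1 - a).toNat := by
    rw [hS, ← Finset.coe_Icc, Set.ncard_coe_finset, Int.card_Icc]
  split_ifs with hle
  · congr 1
    ext x
    change h ≤ opening k f x ↔ h ≤ f x
    refine ⟨fun hx => hx.trans (opening_le x), fun hx => (le_opening_iff hh).2 ?_⟩
    rw [hmem] at hx
    refine ⟨min x (b - k + 1), by omega, by omega, fun y h₁ h₂ => (hmem y).2 (by omega)⟩
  · refine (congrArg Set.ncard (Set.eq_empty_of_forall_notMem fun x hx => ?_)).trans
      (Set.ncard_empty ℤ)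
    obtain ⟨c, h₁, h₂, hall⟩ := (le_opening_iff hh).1 hx
    have hc := (hmem c).1 (hall c le_rfl (by omega))
    have hd := (hmem (c + k - 1)).1 (hall _ (by omega) le_rfl)
    omega

theorem vol_opening_eq_sum {f : ℤ → ℕ} (hf : (Function.support f).Finite) {M : ℕ}
    (hub : ∀ x, f x ≤ M)
    (hrun : ∀ h ∈ Finset.Icc 1 M, IsRun (levelSet h f) (levelSet h f)) {k : ℕ} (hk : 1 ≤ k) :
    vol (opening k f) = ∑ h ∈ Finset.Icc 1 M,
      if k ≤ (levelSet h f).ncard then (levelSet h f).ncard else 0 := by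
  have hsupp : (Function.support (opening k f)).Finite := hf.subset fun x hx => by
    have := opening_le (f := f) (k := k) x
    rw [Function.mem_support] at hx ⊢
    omega
  rw [vol_eq_sum_ncard_levelSet hsupp fun x => (opening_le x).trans (hub x)]
  exact Finset.sum_congr rfl fun h hh =>
    ncard_levelSet_opening hf (Finset.mem_Icc.1 hh).1 hk (hrun h hh)

theorem p_eq_sum {f : ℤ → ℕ} (hf : (Function.support f).Finite) {M : ℕ} (hub : ∀ x, f x ≤ M)
    (hrun : ∀ h ∈ Finset.Icc 1 M, IsRun (levelSet h f) (levelSet h f)) {k : ℕ} (hk : 1 ≤ k) :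
    p k f = (∑ h ∈ Finset.Icc 1 M, if (levelSet h f).ncard = k then (k : ℝ) else 0) / vol f := by
  unfold p
  rw [vol_opening_eq_sum hf hub hrun hk, vol_opening_eq_sum hf hub hrun (Nat.le_succ_of_le hk)]
  push_cast
  rw [← Finset.sum_sub_distrib]
  congr 1
  refine Finset.sum_congr rfl fun h _ => ?_
  rcases lt_trichotomy (levelSet h f).ncard k with hlt | heq | hgt
  · rw [if_neg (by omega), if_neg (by omega), if_neg (by omega), sub_zero]
  · rw [if_pos (by omega), if_neg (by omega), if_pos heq, heq, sub_zero]
  · rw [if_pos (by omega), if_pos (by omega), if_neg (by omega), sub_self]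

/-- uni-peak entropy identity: if every level set `S_h(f)`
(`1 ≤ h ≤ max f`) consists of exactly one run, and the lengths `ℓ_h = |S_h(f)|` are
pairwise distinct, then `p_k(f) = k/V(f)` when `k = ℓ_h` for some `h` and `p_k(f) = 0`
otherwise, and `GI(f)` equals the entropy of the normalized discrete derivatives of
volume. -/
theorem gi_unipeak_entropy (f : ℤ → ℕ) (hf : (Function.support f).Finite)
    (hpos : 0 < vol f) (M : ℕ) (hub : ∀ x : ℤ, f x ≤ M) (hatt : ∃ x : ℤ, f x = M)
    (huni : ∀ h : ℕ, 1 ≤ h → h ≤ M → ∃! R : Set ℤ, IsRun (levelSet h f) R)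
    (hdist : ∀ h h' : ℕ, 1 ≤ h → h ≤ M → 1 ≤ h' → h' ≤ M →
      (levelSet h f).ncard = (levelSet h' f).ncard → h = h') :
    (∀ k : ℕ, 1 ≤ k →
      ((∃ h : ℕ, 1 ≤ h ∧ h ≤ M ∧ (levelSet h f).ncard = k) →
        p k f = (k : ℝ) / (vol f : ℝ)) ∧
      ((¬ ∃ h : ℕ, 1 ≤ h ∧ h ≤ M ∧ (levelSet h f).ncard = k) → p k f = 0)) ∧
    gi f = -∑ h ∈ Finset.Icc 1 M,
      (((levelSet h f).ncard : ℝ) / (vol f : ℝ)) *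
        Real.log (((levelSet h f).ncard : ℝ) / (vol f : ℝ)) := by
  have hrun : ∀ h ∈ Finset.Icc 1 M, IsRun (levelSet h f) (levelSet h f) := fun h hh =>
    isRun_self_of_existsUnique (huni h (Finset.mem_Icc.1 hh).1 (Finset.mem_Icc.1 hh).2)
  have hinj : Set.InjOn (fun h => (levelSet h f).ncard) (Finset.Icc 1 M : Finset ℕ) := by
    intro h hh h' hh' heq
    rw [Finset.mem_coe, Finset.mem_Icc] at hh hh'
    exact hdist h h' hh.1 hh.2 hh'.1 hh'.2 heq
  have hncard_pos : ∀ h ∈ Finset.Icc 1 M, 1 ≤ (levelSet h f).ncard := fun h hh =>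
    (Set.ncard_pos (levelSet_finite hf (Finset.mem_Icc.1 hh).1)).2 (hrun h hh).1
  have hp_of_mem : ∀ h ∈ Finset.Icc 1 M,
      p (levelSet h f).ncard f = ((levelSet h f).ncard : ℝ) / vol f := by
    intro h hh
    rw [p_eq_sum hf hub hrun (hncard_pos h hh), Finset.sum_eq_single_of_mem h hh, if_pos rfl]
    exact fun h' hh' hne => if_neg fun heq => hne (hinj hh' hh heq)
  have hp_of_notMem : ∀ k, 1 ≤ k →
      (¬ ∃ h : ℕ, 1 ≤ h ∧ h ≤ M ∧ (levelSet h f).ncard = k) → p k f = 0 := by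
    intro k hk hno
    rw [p_eq_sum hf hub hrun hk, Finset.sum_eq_zero, zero_div]
    exact fun h hh => if_neg fun heq =>
      hno ⟨h, (Finset.mem_Icc.1 hh).1, (Finset.mem_Icc.1 hh).2, heq⟩
  refine ⟨fun k hk => ⟨?_, hp_of_notMem k hk⟩, ?_⟩
  · rintro ⟨h, h₁, h₂, rfl⟩
    exact hp_of_mem h (Finset.mem_Icc.2 ⟨h₁, h₂⟩)
  · unfold gi
    rw [finsum_mem_eq_sum_of_inter_support_eq _
      (t := (Finset.Icc 1 M).image fun h => (levelSet h f).ncard), Finset.sum_image hinj]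
    · congr 1
      exact Finset.sum_congr rfl fun h hh => by rw [hp_of_mem h hh]
    · ext k
      simp only [Set.mem_inter_iff, Set.mem_Ici, Finset.mem_coe, Finset.mem_image]
      refine and_congr_left fun hk => ⟨fun hk1 => ?_, ?_⟩
      · by_contra hno
        refine hk ?_
        beta_reduce
        rw [hp_of_notMem k hk1, zero_mul]
        rintro ⟨h, h₁, h₂, heq⟩
        exact hno ⟨h, Finset.mem_Icc.2 ⟨h₁, h₂⟩, heq⟩
      · rintro ⟨h, hh, rfl⟩
        exact hncard_pos h hh

end Granulo
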